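/- There is a universal constant C > 0 with the following property. Let T : ℂ^n → ℂ^N be injective with balancing parameter γ, incoherence parameter μ, and ‖γ T*T − I_n‖ < 1. Let Ω = {ω_1,…,ω_m} be i.i.d. uniform random indices in [n] with set of distinct elements Ω', let x ∈ ℂ^n have T x s-sparse with support J ⊆ [N], and let β > 0. If m ≥ C(1+β) μ s (1 − ‖γ T*T − I_n‖)^{-1} [ log N + log( ‖T‖_{1→2} ‖T†‖_{2→∞} ) ], then with probability at least 1 − e^{−β} − 1/n there exists v ∈ ℂ^N satisfying: (i) (T T† − T S_{Ω'}* S_{Ω'} T†)* v = 0; (ii) ‖Π_J ( v − sgn(Tx) )‖_2 ≤ 1/(7 n ‖T‖_{1→2} ‖T†‖_{2→∞}); and (iii) ‖(I_N − Π_J) v‖_∞ ≤ 1/2. -/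

import Mathlib

open scoped BigOperators ENNReal
open Classical MeasureTheory
open scoped Matrix

noncomputable section

namespace TSR

/-- ℓ2 norm of a finite complex vector. -/
def l2norm {d : ℕ} (v : Fin d → ℂ) : ℝ := Real.sqrt (∑ i, ‖v i‖ ^ 2)

/-- ℓ1 norm of a finite complex vector. -/
def l1norm {d : ℕ} (v : Fin d → ℂ) : ℝ := ∑ i, ‖v i‖

/-- ℓ∞ norm of a finite complex vector. -/
def linfnorm {d : ℕ} (v : Fin d → ℂ) : ℝ := ⨆ i, ‖v i‖

/-- Spectral norm (`ℓ2 → ℓ2` operator norm) of a matrix. -/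
def specNorm {d e : ℕ} (A : Matrix (Fin d) (Fin e) ℂ) : ℝ :=
  ‖LinearMap.toContinuousLinearMap (Matrix.toEuclideanLin A)‖

/-- Largest singular value. -/
def sigmaMax {d e : ℕ} (A : Matrix (Fin d) (Fin e) ℂ) : ℝ := specNorm A

/-- Smallest singular value: the infimum of `‖A v‖₂` over unit vectors `v`. -/
def sigmaMin {d e : ℕ} (A : Matrix (Fin d) (Fin e) ℂ) : ℝ :=
  sInf {r : ℝ | ∃ v : Fin e → ℂ, l2norm v = 1 ∧ r = l2norm (A.mulVec v)}

/-- Maximum ℓ2 norm of the columns of a matrix (the `1 → 2` operator norm). -/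
def maxColL2 {d e : ℕ} (A : Matrix (Fin d) (Fin e) ℂ) : ℝ :=
  ⨆ k : Fin e, l2norm (fun i => A i k)

/-- `B` is the Moore–Penrose pseudoinverse of `A` (the four Penrose conditions). -/
def IsMoorePenrose {ι κ : Type*} [Fintype ι] [Fintype κ] [DecidableEq ι] [DecidableEq κ]
    (A : Matrix ι κ ℂ) (B : Matrix κ ι ℂ) : Prop :=
  A * B * A = A ∧ B * A * B = B ∧ (A * B)ᴴ = A * B ∧ (B * A)ᴴ = B * A

/-- `γ > 0` minimizes `‖γ' T*T − I‖` over `γ' > 0` (the balancing parameter). -/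
def IsBalancing {e d : ℕ} (T : Matrix (Fin d) (Fin e) ℂ) (γ : ℝ) : Prop :=
  0 < γ ∧ ∀ γ' : ℝ, 0 < γ' →
    specNorm ((γ : ℂ) • (Tᴴ * T) - 1) ≤ specNorm ((γ' : ℂ) • (Tᴴ * T) - 1)

/-- Local incoherence parameter `n γ ‖A e_k‖_∞²` of the `k`-th column. -/
def locIncoh {e d : ℕ} (γ : ℝ) (A : Matrix (Fin d) (Fin e) ℂ) (k : Fin e) : ℝ :=
  (e : ℝ) * γ * (linfnorm fun i => A i k) ^ 2

/-- The (worst case) incoherence parameter `μ`. -/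
def incoherence {e d : ℕ} (γ : ℝ) (T Ttil : Matrix (Fin d) (Fin e) ℂ) : ℝ :=
  ⨆ k : Fin e, max (locIncoh γ T k) (locIncoh γ⁻¹ Ttil k)

/-- The variable-density weight `√(μ_k μ̃_k)`. -/
def vdWeight {e d : ℕ} (γ : ℝ) (T Ttil : Matrix (Fin d) (Fin e) ℂ) (k : Fin e) : ℝ :=
  Real.sqrt (locIncoh γ T k * locIncoh γ⁻¹ Ttil k)

/-- The average incoherence parameter `μ̄ = (1/n) ∑ √(μ_k μ̃_k)`. -/
def avgIncoh {e d : ℕ} (γ : ℝ) (T Ttil : Matrix (Fin d) (Fin e) ℂ) : ℝ :=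
  (1 / (e : ℝ)) * ∑ k, vdWeight γ T Ttil k

/-- The sampling matrix `S_Ω` of a multiset of indices `ω : Fin m → Fin n`. -/
def sampMat {n m : ℕ} (ω : Fin m → Fin n) : Matrix (Fin m) (Fin n) ℂ :=
  fun j k => if ω j = k then 1 else 0

/-- Coordinate projection `Π_J` onto a set of coordinates, as a matrix. -/
def projMat {d : ℕ} (J : Set (Fin d)) : Matrix (Fin d) (Fin d) ℂ :=
  fun i j => if i = j ∧ i ∈ J then 1 else 0

/-- Number of non-zero entries. -/
def sparsity {d : ℕ} (v : Fin d → ℂ) : ℕ :=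
  (Finset.univ.filter fun i => v i ≠ 0).card

/-- Number of distinct elements of the multiset `Ω` (that is, `|Ω'|`). -/
def distinctCard {n m : ℕ} (ω : Fin m → Fin n) : ℕ :=
  (Finset.image ω Finset.univ).card

/-- Maximal multiplicity of an element of the multiset `Ω`. -/
def maxMult {n m : ℕ} (ω : Fin m → Fin n) : ℕ :=
  Finset.univ.sup fun k : Fin n => (Finset.univ.filter fun j => ω j = k).card

/-- Entrywise complex signum. -/
def csgn {d : ℕ} (z : Fin d → ℂ) : Fin d → ℂ :=
  fun k => if z k = 0 then 0 else z k / (‖z k‖ : ℂ)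

/-- `G` is a partition of the coordinates into disjoint nonempty groups. -/
def IsPartition {L N : ℕ} (G : Fin N → Finset (Fin L)) : Prop :=
  (∀ j, (G j).Nonempty) ∧ (∀ j j', j ≠ j' → Disjoint (G j) (G j')) ∧
    Finset.univ.biUnion G = Finset.univ

/-- The mixed (group) norm `‖z‖_{𝒢,1} = ∑_j ‖Π_{𝒢_j} z‖₂`. -/
def mixedNorm {L N : ℕ} (G : Fin N → Finset (Fin L)) (z : Fin L → ℂ) : ℝ :=
  ∑ j, Real.sqrt (∑ i ∈ G j, ‖z i‖ ^ 2)

/-- `z` is `(s,t)` strongly group sparse with respect to the partition `G`. -/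
def StronglyGroupSparse {L N : ℕ} (G : Fin N → Finset (Fin L)) (s t : ℕ)
    (z : Fin L → ℂ) : Prop :=
  ∃ J : Finset (Fin N), (∀ i, z i ≠ 0 → i ∈ J.biUnion G) ∧
    (J.biUnion G).card ≤ t ∧ J.card ≤ s

/-- Group local incoherence `max_j n γ ‖Π_{𝒢_j} A e_k‖₂²`. -/
def groupLocIncoh {n L N : ℕ} (G : Fin N → Finset (Fin L)) (γ : ℝ)
    (A : Matrix (Fin L) (Fin n) ℂ) (k : Fin n) : ℝ :=
  ⨆ j : Fin N, (n : ℝ) * γ * ∑ i ∈ G j, ‖A i k‖ ^ 2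

/-- Group incoherence parameter `μ_𝒢`. -/
def groupIncoh {n L N : ℕ} (G : Fin N → Finset (Fin L)) (γ : ℝ)
    (T Ttil : Matrix (Fin L) (Fin n) ℂ) : ℝ :=
  ⨆ k : Fin n, max (groupLocIncoh G γ T k) (groupLocIncoh G γ⁻¹ Ttil k)

/-- Group variable density weight `√(μ_{𝒢,k} μ̃_{𝒢,k})`. -/
def groupVdWeight {n L N : ℕ} (G : Fin N → Finset (Fin L)) (γ : ℝ)
    (T Ttil : Matrix (Fin L) (Fin n) ℂ) (k : Fin n) : ℝ :=
  Real.sqrt (groupLocIncoh G γ T k * groupLocIncoh G γ⁻¹ Ttil k)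

/-- Group average incoherence `μ̄_𝒢`. -/
def groupAvgIncoh {n L N : ℕ} (G : Fin N → Finset (Fin L)) (γ : ℝ)
    (T Ttil : Matrix (Fin L) (Fin n) ℂ) : ℝ :=
  (1 / (n : ℝ)) * ∑ k, groupVdWeight G γ T Ttil k

/-- The unitary DFT matrix. -/
def dft (n : ℕ) : Matrix (Fin n) (Fin n) ℂ :=
  fun j k => ((1 / Real.sqrt n : ℝ) : ℂ) *
    Complex.exp (-(2 * Real.pi * Complex.I * (j : ℕ) * (k : ℕ)) / n)


/-! ### Concentration of sums of independent uniform samples, in counting form -/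

theorem card_filter_append {α : Type*} [Fintype α] {a b : ℕ} (P : (Fin (a + b) → α) → Prop)
    [DecidablePred P] :
    (Finset.univ.filter P).card =
      ∑ u : Fin a → α, (Finset.univ.filter fun w : Fin b → α => P (Fin.append u w)).card := by
  simp only [Finset.card_filter]
  rw [← (Fin.appendEquiv a b).sum_comp, Fintype.sum_prod_type]
  rfl

/-- Exponential Markov inequality for a sum of centred uniform samples. -/
theorem card_sum_ge_le {α : Type*} [Fintype α] (M : ℕ) (g : α → ℝ) {B σ θ τ : ℝ}
    (hsum : ∑ k, g k = 0) (hB : ∀ k, |g k| ≤ B)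
    (hσ : ∑ k, g k ^ 2 ≤ Fintype.card α * σ) (hθ : 0 ≤ θ) (hθB : B * θ ≤ 1) :
    ((Finset.univ.filter fun w : Fin M → α => M * τ ≤ ∑ j, g (w j)).card : ℝ) ≤
      (Fintype.card α : ℝ) ^ M * Real.exp (M * (θ ^ 2 * σ - θ * τ)) := by
  have hmgf : ∑ k, Real.exp (θ * g k) ≤ Fintype.card α * Real.exp (θ ^ 2 * σ) := by
    have h1 : ∀ k, Real.exp (θ * g k) ≤ 1 + θ * g k + θ ^ 2 * g k ^ 2 := by
      intro k
      have h : |θ * g k| ≤ 1 := by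
        rw [abs_mul, abs_of_nonneg hθ]
        nlinarith [hB k, mul_le_mul_of_nonneg_left (hB k) hθ]
      have := (abs_le.1 (Real.abs_exp_sub_one_sub_id_le h)).2
      nlinarith
    calc ∑ k, Real.exp (θ * g k) ≤ ∑ k, (1 + θ * g k + θ ^ 2 * g k ^ 2) :=
          Finset.sum_le_sum fun k _ => h1 k
      _ = Fintype.card α + θ ^ 2 * ∑ k, g k ^ 2 := by
          rw [Finset.sum_add_distrib, Finset.sum_add_distrib, ← Finset.mul_sum, ← Finset.mul_sum,
            hsum]
          simp
      _ ≤ Fintype.card α * (θ ^ 2 * σ + 1) := by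
          nlinarith [mul_le_mul_of_nonneg_left hσ (sq_nonneg θ)]
      _ ≤ _ := by gcongr; exact Real.add_one_le_exp _
  calc ((Finset.univ.filter fun w : Fin M → α => M * τ ≤ ∑ j, g (w j)).card : ℝ)
      ≤ ∑ w : Fin M → α, Real.exp (-(θ * (M * τ))) * ∏ j, Real.exp (θ * g (w j)) := by
        rw [Finset.card_filter, Nat.cast_sum]
        refine Finset.sum_le_sum fun w _ => ?_
        rw [← Real.exp_sum, ← Real.exp_add, ← Finset.mul_sum]
        split_ifs with h
        · rw [Nat.cast_one, Real.one_le_exp_iff]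
          nlinarith [mul_le_mul_of_nonneg_left h hθ]
        · simpa using (Real.exp_pos _).le
    _ = Real.exp (-(θ * (M * τ))) * (∑ k, Real.exp (θ * g k)) ^ M := by
        rw [← Finset.mul_sum, Fintype.sum_pow]
    _ ≤ Real.exp (-(θ * (M * τ))) * (Fintype.card α * Real.exp (θ ^ 2 * σ)) ^ M := by
        gcongr
    _ = _ := by
        rw [mul_pow, ← Real.exp_nat_mul, mul_left_comm, ← Real.exp_add]
        ring_nf

/-- Bernstein-type tail bound for sums of centred complex uniform samples. -/
theorem card_norm_sum_gt_le {α : Type*} [Fintype α] (M : ℕ) (g : α → ℂ) {B σ θ τ : ℝ}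
    (hsum : ∑ k, g k = 0) (hB : ∀ k, ‖g k‖ ≤ B)
    (hσ : ∑ k, ‖g k‖ ^ 2 ≤ Fintype.card α * σ) (hθ : 0 ≤ θ) (hθB : B * θ ≤ 1) :
    ((Finset.univ.filter fun w : Fin M → α => M * τ < ‖∑ j, g (w j)‖).card : ℝ) ≤
      4 * ((Fintype.card α : ℝ) ^ M * Real.exp (M * (θ ^ 2 * σ - θ * (τ / 2)))) := by
  have hre : ∑ k, (g k).re = 0 := by rw [← Complex.re_sum, hsum, Complex.zero_re]
  have him : ∑ k, (g k).im = 0 := by rw [← Complex.im_sum, hsum, Complex.zero_im]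
  have hreσ : ∑ k, (g k).re ^ 2 ≤ Fintype.card α * σ :=
    (Finset.sum_le_sum fun k _ => by
      rw [Complex.sq_norm, Complex.normSq_apply]
      nlinarith [sq_nonneg (g k).im]).trans hσ
  have himσ : ∑ k, (g k).im ^ 2 ≤ Fintype.card α * σ :=
    (Finset.sum_le_sum fun k _ => by
      rw [Complex.sq_norm, Complex.normSq_apply]
      nlinarith [sq_nonneg (g k).re]).trans hσ
  have hreB : ∀ k, |(g k).re| ≤ B := fun k => (Complex.abs_re_le_norm _).trans (hB k)
  have himB : ∀ k, |(g k).im| ≤ B := fun k => (Complex.abs_im_le_norm _).trans (hB k)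
  have h1 := card_sum_ge_le M (fun k => (g k).re) (τ := τ / 2) hre hreB hreσ hθ hθB
  have h2 := card_sum_ge_le M (fun k => -(g k).re) (τ := τ / 2) (by simp [hre])
    (by simpa using hreB) (by simpa using hreσ) hθ hθB
  have h3 := card_sum_ge_le M (fun k => (g k).im) (τ := τ / 2) him himB himσ hθ hθB
  have h4 := card_sum_ge_le M (fun k => -(g k).im) (τ := τ / 2) (by simp [him])
    (by simpa using himB) (by simpa using himσ) hθ hθB
  have hsub : (Finset.univ.filter fun w : Fin M → α => M * τ < ‖∑ j, g (w j)‖) ⊆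
      ((Finset.univ.filter fun w : Fin M → α => M * (τ / 2) ≤ ∑ j, (g (w j)).re) ∪
        (Finset.univ.filter fun w : Fin M → α => M * (τ / 2) ≤ ∑ j, -(g (w j)).re)) ∪
      ((Finset.univ.filter fun w : Fin M → α => M * (τ / 2) ≤ ∑ j, (g (w j)).im) ∪
        (Finset.univ.filter fun w : Fin M → α => M * (τ / 2) ≤ ∑ j, -(g (w j)).im)) := by
    intro w hw
    simp only [Finset.mem_filter, Finset.mem_univ, true_and, Finset.mem_union,
      Finset.sum_neg_distrib, ← Complex.re_sum, ← Complex.im_sum] at hw ⊢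
    by_contra! h
    obtain ⟨⟨a1, a2⟩, a3, a4⟩ := h
    have := Complex.norm_le_abs_re_add_abs_im (∑ j, g (w j))
    have b1 : |(∑ j, g (w j)).re| ≤ M * (τ / 2) := abs_le.2 ⟨by linarith, a1.le⟩
    have b2 : |(∑ j, g (w j)).im| ≤ M * (τ / 2) := abs_le.2 ⟨by linarith, a3.le⟩
    linarith
  have hcard := (Finset.card_le_card hsub).trans ((Finset.card_union_le _ _).trans
    (add_le_add (Finset.card_union_le _ _) (Finset.card_union_le _ _)))
  have hcard' := (Nat.cast_le (α := ℝ)).2 hcard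
  push_cast at hcard'
  linarith

/-- The variance of a sum of centred uniform samples is additive. -/
theorem sum_norm_sq_sum {α : Type*} [Fintype α] (M : ℕ) (g : α → ℂ) (hsum : ∑ k, g k = 0) :
    (Fintype.card α : ℝ) * ∑ w : Fin M → α, ‖∑ j, g (w j)‖ ^ 2 =
      M * (Fintype.card α : ℝ) ^ M * ∑ k, ‖g k‖ ^ 2 := by
  induction M with
  | zero => simp
  | succ M ih =>
    have h : ∑ w : Fin (M + 1) → α, ‖∑ j, g (w j)‖ ^ 2 =
        ∑ w : Fin M → α, ∑ k, ‖g k + ∑ j, g (w j)‖ ^ 2 := by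
      rw [← (Fin.consEquiv fun _ => α).sum_comp, Fintype.sum_prod_type, Finset.sum_comm]
      simp [Fin.sum_univ_succ, Fin.consEquiv]
    have h2 : ∀ z : ℂ, ∑ k, ‖g k + z‖ ^ 2 = ∑ k, ‖g k‖ ^ 2 + Fintype.card α * ‖z‖ ^ 2 := by
      intro z
      have : ∀ k, ‖g k + z‖ ^ 2 = ‖g k‖ ^ 2 + ‖z‖ ^ 2 + 2 * (g k * star z).re := fun k => by
        rw [Complex.sq_norm, Complex.normSq_add, Complex.sq_norm, Complex.sq_norm]; rfl
      simp only [this, Finset.sum_add_distrib, ← Finset.mul_sum, ← Complex.re_sum,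
        ← Finset.sum_mul, hsum]
      simp
    rw [h]
    simp only [h2, Finset.sum_add_distrib, ← Finset.mul_sum, ih]
    simp
    ring

theorem sum_norm_sub_mean_sq_le {α : Type*} [Fintype α] (f : α → ℂ) :
    ∑ k, ‖f k - (∑ k', f k') / Fintype.card α‖ ^ 2 ≤ ∑ k, ‖f k‖ ^ 2 := by
  rcases isEmpty_or_nonempty α with h | h
  · simp
  have hc : (Fintype.card α : ℂ) ≠ 0 := by exact_mod_cast Fintype.card_ne_zero
  set z := (∑ k', f k') / (Fintype.card α : ℂ) with hz
  have hs : ∑ k, f k = Fintype.card α * z := by rw [hz]; field_simp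
  have : ∀ k, ‖f k - z‖ ^ 2 = ‖f k‖ ^ 2 + ‖z‖ ^ 2 - 2 * (f k * star z).re := fun k => by
    rw [Complex.sq_norm, Complex.normSq_sub, Complex.sq_norm, Complex.sq_norm]; rfl
  simp only [this, Finset.sum_add_distrib, Finset.sum_sub_distrib, ← Finset.mul_sum,
    ← Complex.re_sum, ← Finset.sum_mul, hs]
  have h2 : ((Fintype.card α : ℂ) * z * star z).re = Fintype.card α * ‖z‖ ^ 2 := by
    rw [mul_assoc, Complex.star_def, Complex.mul_conj, Complex.normSq_eq_norm_sq]
    norm_cast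
  rw [h2]
  have : (0 : ℝ) ≤ Fintype.card α * ‖z‖ ^ 2 := by positivity
  simp only [Finset.sum_const, Finset.card_univ, nsmul_eq_mul]
  linarith

/-! ### One golfing step -/

/-- The deviation of the empirical average of `n U e_ω e_ω^* T^* q` from its mean `U T^* q`. -/
def sampDev {n N M : ℕ} (U T : Matrix (Fin N) (Fin n) ℂ) (q : Fin N → ℂ) (w : Fin M → Fin n) :
    Fin N → ℂ :=
  fun i => ((n : ℂ) / M) * (∑ j, U i (w j) * (Tᴴ.mulVec q) (w j)) - (U.mulVec (Tᴴ.mulVec q)) i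

/-- The bounds on the analysis matrix and its dual used in the golfing scheme. -/
structure GolfBounds {n N : ℕ} (U T : Matrix (Fin N) (Fin n) ℂ) (γ μ : ℝ) : Prop where
  pos_n : 0 < n
  pos_γ : 0 < γ
  pos_μ : 0 < μ
  dual : ∀ i k, n * ‖U i k‖ ^ 2 ≤ γ * μ
  primal : ∀ i k, n * ‖T i k‖ ^ 2 ≤ γ⁻¹ * μ
  adjoint : ∀ q : Fin N → ℂ, ∑ k, ‖(Tᴴ.mulVec q) k‖ ^ 2 ≤ 2 * γ⁻¹ * ∑ i, ‖q i‖ ^ 2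

theorem norm_sum_mul_sq_le {ι : Type*} (J : Finset ι) (f g : ι → ℂ) :
    ‖∑ i ∈ J, f i * g i‖ ^ 2 ≤ (∑ i ∈ J, ‖f i‖ ^ 2) * ∑ i ∈ J, ‖g i‖ ^ 2 := by
  calc ‖∑ i ∈ J, f i * g i‖ ^ 2 ≤ (∑ i ∈ J, ‖f i‖ * ‖g i‖) ^ 2 := by
        gcongr
        exact (norm_sum_le _ _).trans (by simp)
    _ ≤ _ := Finset.sum_mul_sq_le_sq_mul_sq _ _ _

theorem card_bad_step_le {n N : ℕ} {U T : Matrix (Fin N) (Fin n) ℂ} {γ μ : ℝ}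
    (h : GolfBounds U T γ μ) (J : Finset (Fin N)) (hJ : 0 < J.card) {l a R : ℝ} (hl : 1 ≤ l)
    (ha : 1 ≤ a) (hR : 0 < R) (hN : (N : ℝ) ≤ Real.exp l) {M : ℕ} (hM : 0 < M)
    (hMa : 4000 * (μ * J.card * l) ≤ M * a) (q : Fin N → ℂ) (hqJ : ∀ i, i ∉ J → q i = 0)
    (hq : ∑ i, ‖q i‖ ^ 2 ≤ R ^ 2) :
    ((Finset.univ.filter fun w : Fin M → Fin n =>
      ¬ ((∀ i, ‖sampDev U T q w i‖ ≤ a * R / (5 * Real.sqrt J.card)) ∧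
        ∑ i ∈ J, ‖sampDev U T q w i‖ ^ 2 ≤ a / (4 * l) * R ^ 2)).card : ℝ) ≤ (n : ℝ) ^ M / 4 := by
  obtain ⟨hn, hγ, hμ, hU, hT, hop⟩ := h
  have hn' : (0 : ℝ) < n := by exact_mod_cast hn
  have hM' : (0 : ℝ) < M := by exact_mod_cast hM
  have hs : (0 : ℝ) < J.card := by exact_mod_cast hJ
  set s : ℝ := (J.card : ℝ) with hs_def
  set r := Real.sqrt s with hr_def
  have hr : 0 < r := Real.sqrt_pos.2 hs
  have hrs : r ^ 2 = s := Real.sq_sqrt hs.le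
  set y := Tᴴ.mulVec q with hy
  set F : Fin N → Fin n → ℂ := fun i k => n * (U i k * y k) with hF
  set G : Fin N → Fin n → ℂ := fun i k => F i k - (∑ k', F i k') / (n : ℂ) with hG
  have hyk : ∀ k, ‖y k‖ ^ 2 ≤ s * (γ⁻¹ * μ / n) * R ^ 2 := by
    intro k
    have e : y k = ∑ i ∈ J, star (T i k) * q i := by
      rw [hy, Matrix.mulVec, dotProduct]
      refine (Finset.sum_subset (Finset.subset_univ J) fun i _ hi => ?_).symm
      rw [hqJ i hi, mul_zero]
    rw [e]
    refine (norm_sum_mul_sq_le _ _ _).trans ?_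
    gcongr
    · calc ∑ i ∈ J, ‖star (T i k)‖ ^ 2 ≤ ∑ i ∈ J, γ⁻¹ * μ / n := by
            refine Finset.sum_le_sum fun i _ => ?_
            rw [norm_star, le_div_iff₀ hn']
            linarith [hT i k]
        _ = _ := by simp [hs_def]
    · exact (Finset.sum_le_sum_of_subset_of_nonneg (Finset.subset_univ J)
        fun _ _ _ => by positivity).trans hq
  have hFb : ∀ i k, ‖F i k‖ ≤ μ * r * R := by
    intro i k
    refine abs_le_of_sq_le_sq' ?_ (by positivity) |>.2
    calc ‖F i k‖ ^ 2 = n * (n * ‖U i k‖ ^ 2) * ‖y k‖ ^ 2 := by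
          simp only [hF, norm_mul, Complex.norm_natCast]; ring
      _ ≤ n * (γ * μ) * (s * (γ⁻¹ * μ / n) * R ^ 2) := by
          exact mul_le_mul (mul_le_mul_of_nonneg_left (hU i k) hn'.le) (hyk k) (by positivity)
            (by positivity)
      _ = (μ * r * R) ^ 2 := by
          rw [← hrs]; field_simp
  have hF2 : ∀ i, ∑ k, ‖F i k‖ ^ 2 ≤ n * (2 * μ * R ^ 2) := by
    intro i
    calc ∑ k, ‖F i k‖ ^ 2 ≤ ∑ k, n * (γ * μ) * ‖y k‖ ^ 2 := by
          refine Finset.sum_le_sum fun k _ => ?_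
          have : ‖F i k‖ ^ 2 = n * (n * ‖U i k‖ ^ 2) * ‖y k‖ ^ 2 := by
            simp only [hF, norm_mul, Complex.norm_natCast]; ring
          rw [this]
          exact mul_le_mul_of_nonneg_right (mul_le_mul_of_nonneg_left (hU i k) hn'.le)
            (by positivity)
      _ = n * (γ * μ) * ∑ k, ‖y k‖ ^ 2 := by rw [Finset.mul_sum]
      _ ≤ n * (γ * μ) * (2 * γ⁻¹ * R ^ 2) := by
          gcongr
          exact (hop q).trans (by gcongr)
      _ = _ := by field_simp
  have hGsum : ∀ i, ∑ k, G i k = 0 := by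
    intro i
    simp only [hG, Finset.sum_sub_distrib, Finset.sum_const, Finset.card_univ, Fintype.card_fin,
      nsmul_eq_mul]
    have : (n : ℂ) ≠ 0 := by exact_mod_cast hn.ne'
    field_simp
    ring
  have hG2 : ∀ i, ∑ k, ‖G i k‖ ^ 2 ≤ Fintype.card (Fin n) * (2 * μ * R ^ 2) := by
    intro i
    have := sum_norm_sub_mean_sq_le (F i)
    simp only [Fintype.card_fin] at this ⊢
    exact this.trans (hF2 i)
  have hGb : ∀ i k, ‖G i k‖ ≤ 2 * (μ * r * R) := by
    intro i k
    have : ‖(∑ k', F i k') / (n : ℂ)‖ ≤ μ * r * R := by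
      rw [norm_div, Complex.norm_natCast, div_le_iff₀ hn']
      calc ‖∑ k', F i k'‖ ≤ ∑ k' : Fin n, μ * r * R :=
            (norm_sum_le _ _).trans (Finset.sum_le_sum fun k' _ => hFb i k')
        _ = _ := by simp; ring
    linarith [norm_sub_le (F i k) ((∑ k', F i k') / (n : ℂ)), hFb i k]
  have hdev : ∀ (w : Fin M → Fin n) i, sampDev U T q w i = (∑ j, G i (w j)) / M := by
    intro w i
    have h1 : (n : ℂ) ≠ 0 := by exact_mod_cast hn.ne'
    have h2 : (M : ℂ) ≠ 0 := by exact_mod_cast hM.ne'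
    simp only [sampDev, hG, hF, Finset.sum_sub_distrib, Finset.sum_const, Finset.card_univ,
      Fintype.card_fin, nsmul_eq_mul, ← Finset.mul_sum, Matrix.mulVec, dotProduct]
    simp only [hy, Matrix.mulVec, dotProduct]
    field_simp
  have hdevn : ∀ (w : Fin M → Fin n) i, ‖sampDev U T q w i‖ = ‖∑ j, G i (w j)‖ / M := by
    intro w i
    rw [hdev, norm_div, Complex.norm_natCast]
  -- entrywise bound
  have hentry : ∀ i, ((Finset.univ.filter fun w : Fin M → Fin n =>
      M * (a * R / (5 * r)) < ‖∑ j, G i (w j)‖).card : ℝ) ≤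
      4 * ((n : ℝ) ^ M * Real.exp (-5 * l)) := by
    intro i
    have := card_norm_sum_gt_le M (G i) (B := 2 * (μ * r * R)) (σ := 2 * μ * R ^ 2)
      (θ := 1 / (40 * (μ * r * R))) (τ := a * R / (5 * r)) (hGsum i) (hGb i) (hG2 i)
      (by positivity) (by
        rw [mul_one_div, div_le_one (by positivity)]
        have : 0 < μ * r * R := by positivity
        linarith)
    refine this.trans ?_
    rw [Fintype.card_fin]
    gcongr 4 * ((n : ℝ) ^ M * Real.exp ?_)
    have e : (M : ℝ) * ((1 / (40 * (μ * r * R))) ^ 2 * (2 * μ * R ^ 2) -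
        1 / (40 * (μ * r * R)) * (a * R / (5 * r) / 2)) = (M - 2 * (M * a)) / (800 * (μ * s)) := by
      rw [← hrs]
      field_simp
      ring
    rw [e, div_le_iff₀ (by positivity)]
    nlinarith [mul_le_mul_of_nonneg_left ha hM'.le]
  -- energy bound
  have henergy : ((Finset.univ.filter fun w : Fin M → Fin n =>
      ¬ ∑ i ∈ J, ‖sampDev U T q w i‖ ^ 2 ≤ a / (4 * l) * R ^ 2).card : ℝ) ≤ (n : ℝ) ^ M / 8 := by
    have hvar : ∑ w : Fin M → Fin n, ∑ i ∈ J, ‖∑ j, G i (w j)‖ ^ 2 ≤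
        M * (n : ℝ) ^ M * (s * (2 * μ * R ^ 2)) := by
      rw [Finset.sum_comm]
      calc _ ≤ ∑ i ∈ J, M * (n : ℝ) ^ M * (2 * μ * R ^ 2) := by
            refine Finset.sum_le_sum fun i _ => ?_
            have e := sum_norm_sq_sum M (G i) (hGsum i)
            have e2 := hG2 i
            rw [Fintype.card_fin] at e e2
            refine le_of_mul_le_mul_left ?_ hn'
            rw [e]
            calc _ ≤ M * (n : ℝ) ^ M * (n * (2 * μ * R ^ 2)) := by gcongr
              _ = _ := by ring
        _ = _ := by simp [hs_def]; ring
    have hmark : ((Finset.univ.filter fun w : Fin M → Fin n =>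
        ¬ ∑ i ∈ J, ‖sampDev U T q w i‖ ^ 2 ≤ a / (4 * l) * R ^ 2).card : ℝ) *
          (M ^ 2 * (a / (4 * l) * R ^ 2)) ≤
        ∑ w : Fin M → Fin n, ∑ i ∈ J, ‖∑ j, G i (w j)‖ ^ 2 := by
      rw [← nsmul_eq_mul]
      refine (Finset.card_nsmul_le_sum _ (fun w : Fin M → Fin n => ∑ i ∈ J, ‖∑ j, G i (w j)‖ ^ 2) _
        fun w hw => ?_).trans (Finset.sum_le_sum_of_subset_of_nonneg (Finset.subset_univ _)
          fun _ _ _ => Finset.sum_nonneg fun _ _ => by positivity)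
      have hw' := not_le.1 (Finset.mem_filter.1 hw).2
      simp only [hdevn, div_pow, ← Finset.sum_div] at hw'
      rw [lt_div_iff₀ (by positivity)] at hw'
      linarith
    have h3 := hmark.trans hvar
    have hpos : 0 < (M : ℝ) ^ 2 * (a / (4 * l) * R ^ 2) := by positivity
    refine le_of_mul_le_mul_right (h3.trans ?_) hpos
    have : (M : ℝ) * (n : ℝ) ^ M * (s * (2 * μ * R ^ 2)) =
        (64 * (μ * s * l)) * ((M : ℝ) * (n : ℝ) ^ M * R ^ 2 / (32 * l)) := by
      field_simp
      norm_num
    rw [this]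
    calc _ ≤ (M * a) * ((M : ℝ) * (n : ℝ) ^ M * R ^ 2 / (32 * l)) := by
          refine mul_le_mul_of_nonneg_right ?_ (by positivity)
          have : 0 < μ * s * l := by positivity
          linarith
      _ = _ := by field_simp; norm_num
  have hsub : (Finset.univ.filter fun w : Fin M → Fin n =>
      ¬ ((∀ i, ‖sampDev U T q w i‖ ≤ a * R / (5 * r)) ∧
        ∑ i ∈ J, ‖sampDev U T q w i‖ ^ 2 ≤ a / (4 * l) * R ^ 2)) ⊆
      (Finset.univ.biUnion fun i => Finset.univ.filter fun w : Fin M → Fin n =>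
        M * (a * R / (5 * r)) < ‖∑ j, G i (w j)‖) ∪
      (Finset.univ.filter fun w : Fin M → Fin n =>
        ¬ ∑ i ∈ J, ‖sampDev U T q w i‖ ^ 2 ≤ a / (4 * l) * R ^ 2) := by
    intro w hw
    simp only [Finset.mem_filter, Finset.mem_univ, true_and, Finset.mem_union,
      Finset.mem_biUnion, not_and_or, not_forall] at hw ⊢
    refine hw.imp_left fun ⟨i, hi⟩ => ⟨i, ?_⟩
    rw [hdevn, div_le_iff₀ hM'] at hi
    linarith
  have hcard := (Nat.cast_le (α := ℝ)).2 ((Finset.card_le_card hsub).trans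
    ((Finset.card_union_le _ _).trans (add_le_add_left Finset.card_biUnion_le _)))
  push_cast at hcard
  have hall : ∑ i : Fin N, ((Finset.univ.filter fun w : Fin M → Fin n =>
      M * (a * R / (5 * r)) < ‖∑ j, G i (w j)‖).card : ℝ) ≤ (n : ℝ) ^ M / 8 := by
    calc _ ≤ ∑ i : Fin N, 4 * ((n : ℝ) ^ M * Real.exp (-5 * l)) :=
          Finset.sum_le_sum fun i _ => hentry i
      _ = N * (4 * ((n : ℝ) ^ M * Real.exp (-5 * l))) := by simp
      _ ≤ Real.exp l * (4 * ((n : ℝ) ^ M * Real.exp (-5 * l))) := by gcongr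
      _ = 4 * (n : ℝ) ^ M * Real.exp (-(4 * l)) := by
          rw [mul_left_comm, mul_left_comm (Real.exp l), ← Real.exp_add, ← mul_assoc]
          ring_nf
      _ ≤ 4 * (n : ℝ) ^ M * (1 / 32) := by
          gcongr
          rw [Real.exp_neg, ← one_div]
          apply one_div_le_one_div_of_le (by norm_num)
          calc (32 : ℝ) ≤ 2.7 ^ 4 := by norm_num
            _ ≤ Real.exp 1 ^ 4 := by
                gcongr
                linarith [Real.exp_one_gt_d9]
            _ = Real.exp 4 := by rw [← Real.exp_nat_mul]; norm_num
            _ ≤ Real.exp (4 * l) := Real.exp_le_exp.2 (by linarith)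
      _ = _ := by ring
  linarith

/-! ### Stages of the golfing scheme -/

/-- `v`, built from the rows indexed by `S`, approximates `q` on `J` and is small off `J`. -/
def ApproxCert {n N : ℕ} (T : Matrix (Fin N) (Fin n) ℂ) (J : Finset (Fin N)) (S : Set (Fin n))
    (q : Fin N → ℂ) (ε B : ℝ) (v : Fin N → ℂ) : Prop :=
  (∀ k, k ∉ S → (Tᴴ.mulVec v) k = 0) ∧ ∑ i ∈ J, ‖v i - q i‖ ^ 2 ≤ ε ^ 2 ∧ ∀ i, i ∉ J → ‖v i‖ ≤ B

theorem ApproxCert.add {n N : ℕ} {T : Matrix (Fin N) (Fin n) ℂ} {J : Finset (Fin N)}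
    {S S' S'' : Set (Fin n)} {q v v' : Fin N → ℂ} {ε ε' B B' : ℝ}
    (h : ApproxCert T J S q ε B v)
    (h' : ApproxCert T J S' (fun i => if i ∈ J then q i - v i else 0) ε' B' v')
    (hS : S ⊆ S'') (hS' : S' ⊆ S'') : ApproxCert T J S'' q ε' (B + B') (v + v') := by
  refine ⟨fun k hk => ?_, ?_, fun i hi => (norm_add_le _ _).trans
    (add_le_add (h.2.2 i hi) (h'.2.2 i hi))⟩
  · rw [Matrix.mulVec_add, Pi.add_apply, h.1 k fun hh => hk (hS hh),
      h'.1 k fun hh => hk (hS' hh), add_zero]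
  · refine le_of_eq_of_le (Finset.sum_congr rfl fun i hi => ?_) h'.2.1
    simp only [if_pos hi, Pi.add_apply]
    congr 2
    ring

theorem ApproxCert.mono {n N : ℕ} {T : Matrix (Fin N) (Fin n) ℂ} {J : Finset (Fin N)}
    {S S' : Set (Fin n)} {q v : Fin N → ℂ} {ε ε' B B' : ℝ} (h : ApproxCert T J S q ε B v)
    (hS : S ⊆ S') (hε : ε ^ 2 ≤ ε' ^ 2) (hB : B ≤ B') : ApproxCert T J S' q ε' B' v :=
  ⟨fun k hk => h.1 k fun hh => hk (hS hh), h.2.1.trans hε, fun i hi => (h.2.2 i hi).trans hB⟩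

theorem ApproxCert.sum_residual_le {n N : ℕ} {T : Matrix (Fin N) (Fin n) ℂ} {J : Finset (Fin N)}
    {S : Set (Fin n)} {q v : Fin N → ℂ} {ε B : ℝ} (h : ApproxCert T J S q ε B v) :
    ∑ i, ‖(fun i => if i ∈ J then q i - v i else 0 : Fin N → ℂ) i‖ ^ 2 ≤ ε ^ 2 := by
  refine le_of_eq_of_le ?_ h.2.1
  rw [← Finset.sum_subset (Finset.subset_univ J) fun i _ hi => by simp [hi]]
  refine Finset.sum_congr rfl fun i hi => ?_
  simp only [if_pos hi]
  rw [norm_sub_rev]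

theorem range_left_subset_append {α : Type*} {a b : ℕ} (u : Fin a → α) (w : Fin b → α) :
    Set.range u ⊆ Set.range (Fin.append u w) := by
  rintro _ ⟨i, rfl⟩
  exact ⟨Fin.castAdd b i, by simp⟩

theorem range_right_subset_append {α : Type*} {a b : ℕ} (u : Fin a → α) (w : Fin b → α) :
    Set.range w ⊆ Set.range (Fin.append u w) := by
  rintro _ ⟨i, rfl⟩
  exact ⟨Fin.natAdd a i, by simp⟩

theorem adjoint_mulVec_add_sampDev {n N M : ℕ} {U T : Matrix (Fin N) (Fin n) ℂ}
    (hTU : Tᴴ * U = 1) (q : Fin N → ℂ) (w : Fin M → Fin n) {k : Fin n} (hk : k ∉ Set.range w) :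
    (Tᴴ.mulVec (q + sampDev U T q w)) k = 0 := by
  have e : sampDev U T q w = ((n : ℂ) / M) •
      (U.mulVec (∑ j, Pi.single (w j) ((Tᴴ.mulVec q) (w j)))) - U.mulVec (Tᴴ.mulVec q) := by
    funext i
    simp only [sampDev, Pi.sub_apply, Pi.smul_apply, smul_eq_mul, Matrix.mulVec_sum,
      Finset.sum_apply, Matrix.mulVec_single, MulOpposite.smul_eq_mul_unop, Matrix.col_apply,
      MulOpposite.unop_op]
  rw [e, Matrix.mulVec_add, Matrix.mulVec_sub, Matrix.mulVec_smul, Matrix.mulVec_mulVec,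
    Matrix.mulVec_mulVec _ Tᴴ U, hTU, Matrix.one_mulVec, Matrix.one_mulVec]
  have : ∀ j, (Pi.single (w j) ((Tᴴ.mulVec q) (w j)) : Fin n → ℂ) k = 0 := fun j =>
    Pi.single_eq_of_ne (fun h => hk ⟨j, h.symm⟩) _
  simp [Finset.sum_apply, this]

/-- If every batch of `M` samples succeeds with probability at least `3/4`, then `b` batches
produce `r` successes up to probability `4 ^ r * (7 / 16) ^ b`. -/
theorem card_stage_fail_le {n N : ℕ} {U T : Matrix (Fin N) (Fin n) ℂ} {γ μ : ℝ}
    (h : GolfBounds U T γ μ) (hTU : Tᴴ * U = 1) (J : Finset (Fin N)) (hJ : 0 < J.card)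
    {l a ρ : ℝ} (ha : 1 ≤ a) (hal : a ≤ l) (hρ : 0 < ρ) (hρl : ρ ^ 2 = a / (4 * l))
    (hN : (N : ℝ) ≤ Real.exp l) {M : ℕ} (hM : 0 < M) (hMa : 4000 * (μ * J.card * l) ≤ M * a)
    (b r : ℕ) {m : ℕ} (hm : b * M ≤ m) {R : ℝ} (hR : 0 < R) (q : Fin N → ℂ)
    (hqJ : ∀ i, i ∉ J → q i = 0) (hq : ∑ i, ‖q i‖ ^ 2 ≤ R ^ 2) :
    ((Finset.univ.filter fun w : Fin m → Fin n => ¬ ∃ v, ApproxCert T J (Set.range w) q (ρ ^ r * R)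
      (2 * (a * R / (5 * Real.sqrt J.card))) v).card : ℝ) ≤
      4 ^ r * (7 / 16) ^ b * (n : ℝ) ^ m := by
  have hl : 1 ≤ l := ha.trans hal
  have hρ2 : ρ ≤ 1 / 2 := by
    refine abs_le_of_sq_le_sq' ?_ (by norm_num) |>.2
    rw [hρl, div_le_iff₀ (by linarith)]
    linarith
  induction b generalizing r m R q with
  | zero =>
    have h1 := (Nat.cast_le (α := ℝ)).2 (Finset.card_filter_le (Finset.univ : Finset (Fin m → Fin n))
      (fun w => ¬ ∃ v, ApproxCert T J (Set.range w) q (ρ ^ r * R)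
      (2 * (a * R / (5 * Real.sqrt J.card))) v))
    refine h1.trans ?_
    simp only [Finset.card_univ, Fintype.card_pi, Fintype.card_fin, Finset.prod_const]
    push_cast
    have : (1 : ℝ) ≤ 4 ^ r := one_le_pow₀ (by norm_num)
    have h2 : (0 : ℝ) ≤ (n : ℝ) ^ m := by positivity
    nlinarith
  | succ b ih =>
    cases r with
    | zero =>
      rw [Finset.card_eq_zero.2]
      · simp only [Nat.cast_zero]; positivity
      · refine Finset.filter_eq_empty_iff.2 fun w _ => not_not.2 ⟨0, fun k _ => by simp, ?_,
          fun i _ => by rw [Pi.zero_apply, norm_zero]; positivity⟩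
        simp only [Pi.zero_apply, zero_sub, norm_neg, pow_zero, one_mul]
        exact (Finset.sum_le_sum_of_subset_of_nonneg (Finset.subset_univ J)
          fun _ _ _ => by positivity).trans hq
    | succ r =>
      obtain ⟨m', rfl⟩ : ∃ m', m = M + m' := Nat.exists_eq_add_of_le (by
        rw [Nat.succ_mul] at hm; omega)
      have hm' : b * M ≤ m' := by rw [Nat.succ_mul] at hm; omega
      have hbad := card_bad_step_le h J hJ hl ha hR hN hM hMa q hqJ hq
      set good : (Fin M → Fin n) → Prop := fun w =>
        (∀ i, ‖sampDev U T q w i‖ ≤ a * R / (5 * Real.sqrt J.card)) ∧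
        ∑ i ∈ J, ‖sampDev U T q w i‖ ^ 2 ≤ a / (4 * l) * R ^ 2 with hgood
      set p : ℝ := 4 ^ r * (7 / 16) ^ b * (n : ℝ) ^ m' with hp
      have hp0 : 0 ≤ p := by positivity
      have hfib : ∀ u : Fin M → Fin n, ((Finset.univ.filter fun w : Fin m' → Fin n =>
          ¬ ∃ v, ApproxCert T J (Set.range (Fin.append u w)) q (ρ ^ (r + 1) * R)
            (2 * (a * R / (5 * Real.sqrt J.card))) v).card : ℝ) ≤
          p + (if ¬ good u then 3 * p else 0) := by
        intro u
        by_cases hu : good u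
        · simp only [hu, not_true_eq_false, if_false, add_zero]
          have hcert : ApproxCert T J (Set.range u) q (ρ * R) (a * R / (5 * Real.sqrt J.card))
              (q + sampDev U T q u) := by
            refine ⟨fun k hk => adjoint_mulVec_add_sampDev hTU q u hk, ?_, fun i hi => ?_⟩
            · simp only [Pi.add_apply, add_sub_cancel_left]
              rw [mul_pow, hρl]
              exact hu.2
            · rw [Pi.add_apply, hqJ i hi, zero_add]
              exact hu.1 i
          refine le_trans ?_ (ih r hm' (mul_pos hρ hR) _ (fun i hi => if_neg hi)
            hcert.sum_residual_le)
          refine Nat.cast_le.2 (Finset.card_le_card fun w hw => ?_)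
          simp only [Finset.mem_filter, Finset.mem_univ, true_and] at hw ⊢
          refine fun ⟨v, hv⟩ => hw ⟨q + sampDev U T q u + v, ?_⟩
          have := hcert.add hv (range_left_subset_append u w) (range_right_subset_append u w)
          rw [pow_succ, mul_assoc]
          refine this.mono subset_rfl le_rfl ?_
          have h5 : a * (ρ * R) / (5 * Real.sqrt J.card) =
              ρ * (a * R / (5 * Real.sqrt J.card)) := by ring
          have h6 : 0 ≤ a * R / (5 * Real.sqrt J.card) := by positivity
          rw [h5]
          nlinarith
        · simp only [hu, not_false_eq_true, if_true]
          have h7 := ih (r + 1) hm' hR q hqJ hq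
          refine le_trans ?_ (h7.trans (le_of_eq (by rw [hp]; ring)))
          refine Nat.cast_le.2 (Finset.card_le_card fun w hw => ?_)
          simp only [Finset.mem_filter, Finset.mem_univ, true_and] at hw ⊢
          exact fun ⟨v, hv⟩ => hw ⟨v, hv.mono (range_right_subset_append u w) le_rfl le_rfl⟩
      rw [card_filter_append]
      push_cast
      calc _ ≤ ∑ u : Fin M → Fin n, (p + (if ¬ good u then 3 * p else 0)) :=
            Finset.sum_le_sum fun u _ => hfib u
        _ = (n : ℝ) ^ M * p + (Finset.univ.filter fun u => ¬ good u).card * (3 * p) := by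
            rw [Finset.sum_add_distrib, ← Finset.sum_filter]
            simp
        _ ≤ (n : ℝ) ^ M * p + (n : ℝ) ^ M / 4 * (3 * p) := by
            gcongr
        _ = _ := by
            rw [hp, pow_add, pow_succ, pow_succ]
            ring

theorem seven_sixteenths_pow_le (b : ℕ) : (7 / 16 : ℝ) ^ b ≤ Real.exp (-(4 / 5 * b)) := by
  have h : (7 / 16 : ℝ) ≤ Real.exp (-(4 / 5)) := by
    rw [Real.exp_neg, le_inv_comm₀ (by norm_num) (Real.exp_pos _)]
    refine (pow_le_pow_iff_left₀ (Real.exp_pos _).le (by norm_num) (n := 5) (by norm_num)).1 ?_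
    have e : Real.exp (4 / 5) ^ 5 = Real.exp 1 ^ 4 := by
      rw [← Real.exp_nat_mul, ← Real.exp_nat_mul]; norm_num
    rw [e]
    calc Real.exp 1 ^ 4 ≤ 2.72 ^ 4 := by
          gcongr
          linarith [Real.exp_one_lt_d9]
      _ ≤ _ := by norm_num
  calc (7 / 16 : ℝ) ^ b ≤ Real.exp (-(4 / 5)) ^ b := by gcongr
    _ = _ := by rw [← Real.exp_nat_mul]; ring_nf

theorem four_pow_le (r : ℕ) : (4 : ℝ) ^ r ≤ Real.exp (3 / 2 * r) := by
  have h : (4 : ℝ) ≤ Real.exp (3 / 2) := by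
    refine (pow_le_pow_iff_left₀ (by norm_num) (Real.exp_pos _).le (n := 2) (by norm_num)).1 ?_
    have e : Real.exp (3 / 2) ^ 2 = Real.exp 1 ^ 3 := by
      rw [← Real.exp_nat_mul, ← Real.exp_nat_mul]; norm_num
    rw [e]
    calc (4 : ℝ) ^ 2 ≤ 2.7 ^ 3 := by norm_num
      _ ≤ _ := by
        gcongr
        linarith [Real.exp_one_gt_d9]
  calc (4 : ℝ) ^ r ≤ Real.exp (3 / 2) ^ r := by gcongr
    _ = _ := by rw [← Real.exp_nat_mul]; ring_nf

theorem half_pow_le (r : ℕ) : (1 / 2 : ℝ) ^ r ≤ Real.exp (-(2 / 3 * r)) := by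
  have h : (1 / 2 : ℝ) ≤ Real.exp (-(2 / 3)) := by
    rw [Real.exp_neg, le_inv_comm₀ (by norm_num) (Real.exp_pos _)]
    refine (pow_le_pow_iff_left₀ (Real.exp_pos _).le (by norm_num) (n := 3) (by norm_num)).1 ?_
    have e : Real.exp (2 / 3) ^ 3 = Real.exp 1 ^ 2 := by
      rw [← Real.exp_nat_mul, ← Real.exp_nat_mul]; norm_num
    rw [e]
    calc Real.exp 1 ^ 2 ≤ 2.72 ^ 2 := by
          gcongr
          linarith [Real.exp_one_lt_d9]
      _ ≤ _ := by norm_num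
  calc (1 / 2 : ℝ) ^ r ≤ Real.exp (-(2 / 3)) ^ r := by gcongr
    _ = _ := by rw [← Real.exp_nat_mul]; ring_nf

/-- Two consecutive stages fail with at most the sum of their failure probabilities. -/
theorem card_two_stages_fail_le {n N m₁ m₂ : ℕ} {T : Matrix (Fin N) (Fin n) ℂ}
    {J : Finset (Fin N)} {q : Fin N → ℂ} {ε₁ ε₂ B₁ B₂ p₁ p₂ : ℝ} (hp₂ : 0 ≤ p₂)
    (h₁ : ((Finset.univ.filter fun u : Fin m₁ → Fin n =>
      ¬ ∃ v, ApproxCert T J (Set.range u) q ε₁ B₁ v).card : ℝ) ≤ p₁ * (n : ℝ) ^ m₁)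
    (h₂ : ∀ q' : Fin N → ℂ, (∀ i, i ∉ J → q' i = 0) → ∑ i, ‖q' i‖ ^ 2 ≤ ε₁ ^ 2 →
      ((Finset.univ.filter fun w : Fin m₂ → Fin n =>
        ¬ ∃ v, ApproxCert T J (Set.range w) q' ε₂ B₂ v).card : ℝ) ≤ p₂ * (n : ℝ) ^ m₂) :
    ((Finset.univ.filter fun w : Fin (m₁ + m₂) → Fin n =>
      ¬ ∃ v, ApproxCert T J (Set.range w) q ε₂ (B₁ + B₂) v).card : ℝ) ≤
      (p₁ + p₂) * (n : ℝ) ^ (m₁ + m₂) := by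
  set pA : (Fin m₁ → Fin n) → Prop := fun u =>
    ∃ v, ApproxCert T J (Set.range u) q ε₁ B₁ v with hpA
  have hfib : ∀ u : Fin m₁ → Fin n, ((Finset.univ.filter fun w : Fin m₂ → Fin n =>
      ¬ ∃ v, ApproxCert T J (Set.range (Fin.append u w)) q ε₂ (B₁ + B₂) v).card : ℝ) ≤
      p₂ * (n : ℝ) ^ m₂ + (if ¬ pA u then (n : ℝ) ^ m₂ else 0) := by
    intro u
    by_cases hu : pA u
    · simp only [hu, not_true_eq_false, if_false, add_zero]
      obtain ⟨v, hv⟩ := hu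
      refine le_trans ?_ (h₂ _ (fun i hi => if_neg hi) hv.sum_residual_le)
      refine Nat.cast_le.2 (Finset.card_le_card fun w hw => ?_)
      simp only [Finset.mem_filter, Finset.mem_univ, true_and] at hw ⊢
      exact fun ⟨v', hv'⟩ => hw ⟨v + v', hv.add hv' (range_left_subset_append u w)
        (range_right_subset_append u w)⟩
    · simp only [hu, not_false_eq_true, if_true]
      refine le_trans (Nat.cast_le.2 (Finset.card_filter_le _ _)) ?_
      simp only [Finset.card_univ, Fintype.card_pi, Fintype.card_fin, Finset.prod_const]
      push_cast
      have : (0 : ℝ) ≤ p₂ * (n : ℝ) ^ m₂ := by positivity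
      linarith
  rw [card_filter_append]
  push_cast
  calc _ ≤ ∑ u : Fin m₁ → Fin n,
        (p₂ * (n : ℝ) ^ m₂ + (if ¬ pA u then (n : ℝ) ^ m₂ else 0)) :=
        Finset.sum_le_sum fun u _ => hfib u
    _ = (n : ℝ) ^ m₁ * (p₂ * (n : ℝ) ^ m₂) +
        (Finset.univ.filter fun u => ¬ pA u).card * (n : ℝ) ^ m₂ := by
        rw [Finset.sum_add_distrib, ← Finset.sum_filter]
        simp
    _ ≤ (n : ℝ) ^ m₁ * (p₂ * (n : ℝ) ^ m₂) + p₁ * (n : ℝ) ^ m₁ * (n : ℝ) ^ m₂ := by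
        gcongr
    _ = _ := by rw [pow_add]; ring

theorem two_successes_fail_le {β : ℝ} {b : ℕ} (hβ : 0 < β) (hb : 5 * (1 + β) ≤ b) :
    (4 : ℝ) ^ 2 * (7 / 16) ^ b ≤ Real.exp (-β) / 2 := by
  calc (4 : ℝ) ^ 2 * (7 / 16) ^ b ≤ 4 ^ 2 * Real.exp (-4 + -β) := by
        gcongr
        exact (seven_sixteenths_pow_le b).trans (Real.exp_le_exp.2 (by linarith))
    _ = Real.exp (-β) * (16 * Real.exp (-4)) := by rw [Real.exp_add]; ring
    _ ≤ Real.exp (-β) * (1 / 2) := by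
        gcongr
        rw [Real.exp_neg, ← div_eq_mul_inv, div_le_iff₀ (Real.exp_pos _)]
        have e : Real.exp 4 = Real.exp 1 ^ 4 := by rw [← Real.exp_nat_mul]; norm_num
        have : (2.7 : ℝ) ^ 4 ≤ Real.exp 1 ^ 4 := by
          gcongr
          linarith [Real.exp_one_gt_d9]
        rw [e]
        norm_num at this ⊢
        linarith
    _ = _ := by ring

theorem many_successes_fail_le {l β : ℝ} {b r : ℕ} (hl : 1 ≤ l) (hβ : 0 < β)
    (hb : 10 * l * (1 + β) ≤ b) (hr : (r : ℝ) ≤ 4 * l) :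
    (4 : ℝ) ^ r * (7 / 16) ^ b ≤ Real.exp (-β) / 2 := by
  calc (4 : ℝ) ^ r * (7 / 16) ^ b ≤ Real.exp (3 / 2 * r) * Real.exp (-(4 / 5 * b)) :=
        mul_le_mul (four_pow_le r) (seven_sixteenths_pow_le b) (by positivity)
          (Real.exp_pos _).le
    _ = Real.exp (3 / 2 * r + -(4 / 5 * b)) := by rw [Real.exp_add]
    _ ≤ Real.exp (-β + -1) := by
        apply Real.exp_le_exp.2
        nlinarith
    _ = Real.exp (-β) * Real.exp (-1) := Real.exp_add _ _
    _ ≤ Real.exp (-β) * (1 / 2) := by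
        gcongr
        rw [Real.exp_neg, one_div]
        apply inv_anti₀ (by norm_num)
        linarith [Real.exp_one_gt_d9]
    _ = _ := by ring

/-- The golfing scheme, counting the samples for which it fails. -/
theorem card_golfing_fail_le {n N : ℕ} {U T : Matrix (Fin N) (Fin n) ℂ} {γ μ : ℝ}
    (h : GolfBounds U T γ μ) (hTU : Tᴴ * U = 1) (J : Finset (Fin N)) (hJ : 0 < J.card)
    (hμJ : 1 / 2 ≤ μ * J.card) {l β : ℝ} (hl : 1 ≤ l) (hβ : 0 < β) (hN : (N : ℝ) ≤ Real.exp l)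
    {m : ℕ} (hm : 136000 * (1 + β) * (μ * J.card) * l ≤ m) (q : Fin N → ℂ)
    (hqJ : ∀ i, i ∉ J → q i = 0) (hq : ∀ i, ‖q i‖ ≤ 1) :
    ((Finset.univ.filter fun w : Fin m → Fin n => ¬ ∃ v, ApproxCert T J (Set.range w) q
      (Real.exp (-(2 * l)) * (Real.sqrt J.card / 4)) (1 / 2) v).card : ℝ) ≤
      Real.exp (-β) * (n : ℝ) ^ m := by
  have hl0 : 0 < l := by linarith
  have hs : (0 : ℝ) < J.card := by exact_mod_cast hJ
  set s : ℝ := (J.card : ℝ) with hs_def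
  have hr : 0 < Real.sqrt s := Real.sqrt_pos.2 hs
  have hrl : 0 < Real.sqrt l := Real.sqrt_pos.2 hl0
  have hrl2 : Real.sqrt l ^ 2 = l := Real.sq_sqrt hl0.le
  have hμs : 0 < μ * s := by linarith
  set M₁ := ⌈4000 * (μ * s * l)⌉₊ with hM₁
  set M₂ := ⌈4000 * (μ * s)⌉₊ with hM₂
  set b₁ := ⌈5 * (1 + β)⌉₊ with hb₁
  set b₂ := ⌈10 * l * (1 + β)⌉₊ with hb₂
  set r := ⌈3 * l⌉₊ with hr_def
  have hμsl : μ * s ≤ μ * s * l := le_mul_of_one_le_right hμs.le hl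
  have hlβ : 1 ≤ l * (1 + β) := by nlinarith
  have M₁lo : 4000 * (μ * s * l) ≤ M₁ := Nat.le_ceil _
  have M₁hi : (M₁ : ℝ) ≤ 8000 * (μ * s * l) := by
    linarith [Nat.ceil_lt_add_one (a := 4000 * (μ * s * l)) (by linarith)]
  have M₂lo : 4000 * (μ * s) ≤ M₂ := Nat.le_ceil _
  have M₂hi : (M₂ : ℝ) ≤ 8000 * (μ * s) := by
    linarith [Nat.ceil_lt_add_one (a := 4000 * (μ * s)) (by linarith)]
  have b₁lo : 5 * (1 + β) ≤ b₁ := Nat.le_ceil _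
  have b₁hi : (b₁ : ℝ) ≤ 6 * (1 + β) := by
    linarith [Nat.ceil_lt_add_one (a := 5 * (1 + β)) (by linarith)]
  have b₂lo : 10 * l * (1 + β) ≤ b₂ := Nat.le_ceil _
  have b₂hi : (b₂ : ℝ) ≤ 11 * (l * (1 + β)) := by
    linarith [Nat.ceil_lt_add_one (a := 10 * l * (1 + β)) (by linarith)]
  have rlo : 3 * l ≤ r := Nat.le_ceil _
  have rhi : (r : ℝ) ≤ 4 * l := by
    linarith [Nat.ceil_lt_add_one (a := 3 * l) (by linarith)]
  have hM₁pos : 0 < M₁ := Nat.ceil_pos.2 (by linarith)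
  have hM₂pos : 0 < M₂ := Nat.ceil_pos.2 (by linarith)
  clear_value M₁ M₂ b₁ b₂ r
  have htot : b₁ * M₁ + b₂ * M₂ ≤ m := by
    rw [← Nat.cast_le (α := ℝ)]
    push_cast
    calc (b₁ : ℝ) * M₁ + b₂ * M₂ ≤ 6 * (1 + β) * (8000 * (μ * s * l)) +
          11 * (l * (1 + β)) * (8000 * (μ * s)) := by gcongr
      _ = 136000 * (1 + β) * (μ * s) * l := by ring
      _ ≤ m := hm
  obtain ⟨m', rfl⟩ := Nat.exists_eq_add_of_le ((Nat.le_add_right _ _).trans htot)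
  have hm' : b₂ * M₂ ≤ m' := by omega
  have hq2 : ∑ i, ‖q i‖ ^ 2 ≤ Real.sqrt s ^ 2 := by
    rw [Real.sq_sqrt hs.le, ← Finset.sum_subset (Finset.subset_univ J)
      fun i _ hi => by rw [hqJ i hi]; simp]
    calc ∑ i ∈ J, ‖q i‖ ^ 2 ≤ ∑ i ∈ J, 1 :=
          Finset.sum_le_sum fun i _ => pow_le_one₀ (norm_nonneg _) (hq i)
      _ = s := by simp [hs_def]
  have hA := card_stage_fail_le h hTU J hJ (l := l) (a := 1) (ρ := 1 / (2 * Real.sqrt l)) le_rfl hl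
    (by positivity) (by rw [div_pow, mul_pow, hrl2]; norm_num) hN hM₁pos (by linarith)
    b₁ 2 le_rfl hr q hqJ hq2
  have hRA : (1 / (2 * Real.sqrt l)) ^ 2 * Real.sqrt s = Real.sqrt s / (4 * l) := by
    rw [div_pow, mul_pow, hrl2]; ring
  have hBA : 2 * (1 * Real.sqrt s / (5 * Real.sqrt s)) = 2 / 5 := by field_simp
  rw [← hs_def, hRA, hBA] at hA
  have hR₁ : 0 < Real.sqrt s / (4 * l) := by positivity
  have hB := card_stage_fail_le h hTU J hJ (l := l) (a := l) (ρ := 1 / 2) hl le_rfl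
    (by norm_num) (by field_simp; norm_num) hN hM₂pos
    (by nlinarith [mul_le_mul_of_nonneg_right M₂lo hl0.le]) b₂ r hm' hR₁
  have hBB : 2 * (l * (Real.sqrt s / (4 * l)) / (5 * Real.sqrt s)) = 1 / 10 := by
    field_simp; norm_num
  rw [← hs_def, hBB] at hB
  have hεA : ((1 / 2 : ℝ) ^ r * (Real.sqrt s / (4 * l))) ^ 2 ≤
      (Real.exp (-(2 * l)) * (Real.sqrt s / 4)) ^ 2 := by
    gcongr ?_ ^ 2
    refine mul_le_mul ((half_pow_le r).trans (Real.exp_le_exp.2 (by linarith))) ?_ hR₁.le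
      (Real.exp_pos _).le
    gcongr
    linarith
  have hcomp := card_two_stages_fail_le (p₁ := Real.exp (-β) / 2) (p₂ := Real.exp (-β) / 2)
    (by positivity) (hA.trans (mul_le_mul_of_nonneg_right (two_successes_fail_le hβ b₁lo)
      (by positivity)))
    (fun q' hq'J hq' => (hB q' hq'J hq').trans (mul_le_mul_of_nonneg_right
      (many_successes_fail_le hl hβ b₂lo rhi) (by positivity)))
  rw [add_halves] at hcomp
  refine le_trans (Nat.cast_le.2 (Finset.card_le_card fun w hw => ?_)) hcomp
  simp only [Finset.mem_filter, Finset.mem_univ, true_and] at hw ⊢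
  exact fun ⟨v, hv⟩ => hw ⟨v, hv.mono subset_rfl hεA (by norm_num)⟩

/-! ### Consequences of the hypotheses on `T` -/

theorem mul_eq_one_of_isMoorePenrose {n N : ℕ} {T : Matrix (Fin N) (Fin n) ℂ}
    {Tdag : Matrix (Fin n) (Fin N) ℂ} (hinj : Function.Injective T.mulVec)
    (h : IsMoorePenrose T Tdag) : Tdag * T = 1 := by
  refine Matrix.ext_iff_mulVec.2 fun x => hinj ?_
  rw [Matrix.mulVec_mulVec, ← Matrix.mul_assoc, h.1, Matrix.one_mulVec]

theorem sum_norm_sq_mulVec_le_of_specNorm {d e : ℕ} {A : Matrix (Fin d) (Fin e) ℂ}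
    (hA : specNorm A ≤ 1) (x : Fin e → ℂ) : ∑ i, ‖(A.mulVec x) i‖ ^ 2 ≤ ∑ i, ‖x i‖ ^ 2 := by
  have h := (LinearMap.toContinuousLinearMap (Matrix.toEuclideanLin A)).le_of_opNorm_le hA
    (WithLp.toLp 2 x)
  rw [one_mul] at h
  have h2 := pow_le_pow_left₀ (norm_nonneg _) h 2
  rw [EuclideanSpace.norm_sq_eq, EuclideanSpace.norm_sq_eq] at h2
  simpa using h2

theorem dotProduct_gram_mulVec {d e : ℕ} (T : Matrix (Fin d) (Fin e) ℂ) (x : Fin e → ℂ) :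
    star x ⬝ᵥ (Tᴴ * T).mulVec x = ((∑ i, ‖(T.mulVec x) i‖ ^ 2 : ℝ) : ℂ) := by
  rw [← Matrix.mulVec_mulVec, Matrix.dotProduct_mulVec, ← Matrix.star_mulVec, dotProduct]
  push_cast
  refine Finset.sum_congr rfl fun i _ => ?_
  rw [Pi.star_apply, Complex.star_def, Complex.conj_mul']

theorem sum_norm_sq_mulVec_le {n N : ℕ} {T : Matrix (Fin N) (Fin n) ℂ} {γ : ℝ} (hγ : 0 < γ)
    (h : specNorm ((γ : ℂ) • (Tᴴ * T) - 1) ≤ 1) (x : Fin n → ℂ) :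
    ∑ i, ‖(T.mulVec x) i‖ ^ 2 ≤ 2 * γ⁻¹ * ∑ k, ‖x k‖ ^ 2 := by
  set E := (γ : ℂ) • (Tᴴ * T) - 1 with hE
  set X := ∑ k, ‖x k‖ ^ 2 with hX
  have hX0 : 0 ≤ X := Finset.sum_nonneg fun _ _ => by positivity
  have h1 : ‖star x ⬝ᵥ E.mulVec x‖ ≤ X := by
    refine abs_le_of_sq_le_sq' ?_ hX0 |>.2
    refine (norm_sum_mul_sq_le Finset.univ (star x) (E.mulVec x)).trans ?_
    rw [sq]
    refine mul_le_mul (le_of_eq ?_) (sum_norm_sq_mulVec_le_of_specNorm h x)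
      (Finset.sum_nonneg fun _ _ => by positivity) hX0
    simp [hX]
  have h2 : star x ⬝ᵥ E.mulVec x = ((γ * ∑ i, ‖(T.mulVec x) i‖ ^ 2 - X : ℝ) : ℂ) := by
    rw [hE, Matrix.sub_mulVec, Matrix.smul_mulVec, dotProduct_sub, dotProduct_smul,
      dotProduct_gram_mulVec, Matrix.one_mulVec]
    have : star x ⬝ᵥ x = (X : ℂ) := by
      rw [dotProduct, hX]
      push_cast
      refine Finset.sum_congr rfl fun i _ => ?_
      rw [Pi.star_apply, Complex.star_def, Complex.conj_mul']
    rw [this]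
    push_cast
    simp
  rw [h2, Complex.norm_real] at h1
  have h3 := (abs_le.1 h1).2
  rw [mul_assoc, mul_comm γ⁻¹, ← mul_assoc, ← div_eq_mul_inv, le_div_iff₀ hγ]
  linarith

theorem sum_norm_sq_adjoint_mulVec_le {n N : ℕ} {T : Matrix (Fin N) (Fin n) ℂ} {γ : ℝ}
    (hγ : 0 < γ) (h : specNorm ((γ : ℂ) • (Tᴴ * T) - 1) ≤ 1) (q : Fin N → ℂ) :
    ∑ k, ‖(Tᴴ.mulVec q) k‖ ^ 2 ≤ 2 * γ⁻¹ * ∑ i, ‖q i‖ ^ 2 := by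
  set y := Tᴴ.mulVec q with hy
  set Y := ∑ k, ‖y k‖ ^ 2 with hY
  have hY0 : 0 ≤ Y := Finset.sum_nonneg fun _ _ => by positivity
  have e : star q ⬝ᵥ T.mulVec y = (Y : ℂ) := by
    rw [Matrix.dotProduct_mulVec]
    have : star q ᵥ* T = star y := by
      rw [hy, Matrix.star_mulVec, Matrix.conjTranspose_conjTranspose]
    rw [this, dotProduct, hY]
    push_cast
    refine Finset.sum_congr rfl fun i _ => ?_
    rw [Pi.star_apply, Complex.star_def, Complex.conj_mul']
  have h1 := norm_sum_mul_sq_le Finset.univ (star q) (T.mulVec y)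
  change ‖star q ⬝ᵥ T.mulVec y‖ ^ 2 ≤ _ at h1
  rw [e, Complex.norm_real, Real.norm_eq_abs, sq_abs] at h1
  simp only [Pi.star_apply, norm_star] at h1
  have h2 := sum_norm_sq_mulVec_le hγ h y
  have h3 : Y ^ 2 ≤ (∑ i, ‖q i‖ ^ 2) * (2 * γ⁻¹ * Y) :=
    h1.trans (mul_le_mul_of_nonneg_left h2 (Finset.sum_nonneg fun _ _ => by positivity))
  rcases hY0.eq_or_lt with h0 | h0
  · rw [← h0]; positivity
  · refine le_of_mul_le_mul_right ?_ h0
    linarith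

theorem norm_sq_le_incoherence {n N : ℕ} {T U : Matrix (Fin N) (Fin n) ℂ} {γ : ℝ} (hγ : 0 < γ)
    (i : Fin N) (k : Fin n) :
    n * ‖U i k‖ ^ 2 ≤ γ * incoherence γ T U ∧ n * ‖T i k‖ ^ 2 ≤ γ⁻¹ * incoherence γ T U := by
  have hk := le_ciSup (Set.finite_range fun k : Fin n =>
    max (locIncoh γ T k) (locIncoh γ⁻¹ U k)).bddAbove k
  have hle : ∀ A : Matrix (Fin N) (Fin n) ℂ, ‖A i k‖ ^ 2 ≤ (linfnorm fun i => A i k) ^ 2 :=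
    fun A => pow_le_pow_left₀ (norm_nonneg _)
      (le_ciSup (Set.finite_range fun i => ‖A i k‖).bddAbove i) 2
  have hloc : ∀ (c : ℝ) (A : Matrix (Fin N) (Fin n) ℂ), 0 < c →
      n * ‖A i k‖ ^ 2 ≤ c⁻¹ * locIncoh c A k := by
    intro c A hc
    rw [locIncoh, inv_mul_eq_div, le_div_iff₀ hc]
    nlinarith [mul_le_mul_of_nonneg_left (hle A) (mul_nonneg (Nat.cast_nonneg (α := ℝ) n) hc.le)]
  refine ⟨?_, ?_⟩
  · refine (hloc γ⁻¹ U (inv_pos.2 hγ)).trans ?_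
    rw [inv_inv]
    exact mul_le_mul_of_nonneg_left ((le_max_right _ _).trans hk) hγ.le
  · exact (hloc γ T hγ).trans
      (mul_le_mul_of_nonneg_left ((le_max_left _ _).trans hk) (inv_pos.2 hγ).le)

/-- An uncertainty principle: nonzero transform-sparse vectors force `μ s` to be large. -/
theorem half_le_mul_card_support {n N : ℕ} {T : Matrix (Fin N) (Fin n) ℂ}
    {Tdag : Matrix (Fin n) (Fin N) ℂ} {γ μ : ℝ} (hn : 0 < n) (hγ : 0 < γ)
    (h1 : Tdag * T = 1) (hU : ∀ i k, n * ‖Tdagᴴ i k‖ ^ 2 ≤ γ * μ)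
    (hT : ∀ x : Fin n → ℂ, ∑ i, ‖(T.mulVec x) i‖ ^ 2 ≤ 2 * γ⁻¹ * ∑ k, ‖x k‖ ^ 2)
    (x : Fin n → ℂ) (hx : x ≠ 0) (J : Finset (Fin N)) (hJ : ∀ i, i ∉ J → (T.mulVec x) i = 0) :
    1 / 2 ≤ μ * J.card := by
  have hn' : (0 : ℝ) < n := by exact_mod_cast hn
  set X := ∑ k, ‖x k‖ ^ 2 with hX
  have hX0 : 0 < X := by
    obtain ⟨k, hk⟩ := Function.ne_iff.1 hx
    exact Finset.sum_pos' (fun _ _ => by positivity) ⟨k, Finset.mem_univ _, by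
      have : 0 < ‖x k‖ := norm_pos_iff.2 hk
      positivity⟩
  have hk : ∀ k, ‖x k‖ ^ 2 ≤ J.card * (γ * μ / n) * (2 * γ⁻¹ * X) := by
    intro k
    have e : x k = ∑ i ∈ J, Tdag k i * (T.mulVec x) i := by
      have : x = Tdag.mulVec (T.mulVec x) := by
        rw [Matrix.mulVec_mulVec, h1, Matrix.one_mulVec]
      conv_lhs => rw [this]
      rw [Matrix.mulVec, dotProduct]
      exact (Finset.sum_subset (Finset.subset_univ J) fun i _ hi => by rw [hJ i hi, mul_zero]).symm
    have hs : ∑ i ∈ J, ‖Tdag k i‖ ^ 2 ≤ J.card * (γ * μ / n) := by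
      calc ∑ i ∈ J, ‖Tdag k i‖ ^ 2 ≤ ∑ i ∈ J, γ * μ / n := by
            refine Finset.sum_le_sum fun i _ => ?_
            have := hU i k
            rw [Matrix.conjTranspose_apply, norm_star] at this
            rw [le_div_iff₀ hn']
            linarith
        _ = _ := by simp
    rw [e]
    refine (norm_sum_mul_sq_le _ _ _).trans (mul_le_mul hs ?_
      (Finset.sum_nonneg fun _ _ => by positivity)
      ((Finset.sum_nonneg fun _ _ => by positivity).trans hs))
    exact (Finset.sum_le_sum_of_subset_of_nonneg (Finset.subset_univ J)
      fun _ _ _ => by positivity).trans (hT x)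
  have hsum : X ≤ n * (J.card * (γ * μ / n) * (2 * γ⁻¹ * X)) := by
    calc X ≤ ∑ k : Fin n, J.card * (γ * μ / n) * (2 * γ⁻¹ * X) :=
          Finset.sum_le_sum fun k _ => hk k
      _ = _ := by simp
  have e : n * (J.card * (γ * μ / n) * (2 * γ⁻¹ * X)) = 2 * (μ * J.card) * X := by field_simp
  rw [e] at hsum
  have := le_of_mul_le_mul_right (by linarith : 1 * X ≤ 2 * (μ * J.card) * X) hX0
  linarith

theorem l2norm_sq {d : ℕ} (v : Fin d → ℂ) : l2norm v ^ 2 = ∑ i, ‖v i‖ ^ 2 :=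
  Real.sq_sqrt (Finset.sum_nonneg fun _ _ => by positivity)

theorem l2norm_nonneg {d : ℕ} (v : Fin d → ℂ) : 0 ≤ l2norm v := Real.sqrt_nonneg _

theorem one_le_maxColL2_mul {n N : ℕ} (hn : 0 < n) {T : Matrix (Fin N) (Fin n) ℂ}
    {Tdag : Matrix (Fin n) (Fin N) ℂ} (h1 : Tdag * T = 1) :
    1 ≤ maxColL2 T * maxColL2 Tdagᴴ := by
  let k : Fin n := ⟨0, hn⟩
  have hle : ∀ A : Matrix (Fin N) (Fin n) ℂ, l2norm (fun i => A i k) ≤ maxColL2 A := fun A =>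
    le_ciSup (Set.finite_range fun k : Fin n => l2norm (fun i => A i k)).bddAbove k
  refine le_trans ?_ (mul_le_mul (hle T) (hle Tdagᴴ) (l2norm_nonneg _)
    ((l2norm_nonneg _).trans (hle T)))
  have e : ∑ i, Tdag k i * T i k = 1 := by
    rw [← Matrix.mul_apply, h1, Matrix.one_apply_eq]
  have h := norm_sum_mul_sq_le Finset.univ (fun i => Tdag k i) (fun i => T i k)
  rw [e, norm_one, one_pow] at h
  refine abs_le_of_sq_le_sq' ?_ (mul_nonneg (l2norm_nonneg _) (l2norm_nonneg _)) |>.2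
  rw [mul_pow, l2norm_sq, l2norm_sq]
  simp only [Matrix.conjTranspose_apply, norm_star]
  linarith

theorem card_le_of_mulVec_injective {n N : ℕ} {T : Matrix (Fin N) (Fin n) ℂ}
    (hinj : Function.Injective T.mulVec) : n ≤ N := by
  have := LinearMap.finrank_le_finrank_of_injective (f := T.mulVecLin) hinj
  simpa using this

/-- From counting to probability for i.i.d. uniform samples. -/
theorem ofReal_le_pi_of_card_le {n m : ℕ} (hn : 0 < n) (ν : Measure (Fin n))
    [IsProbabilityMeasure ν] (hν : ∀ k, ν {k} = (n : ℝ≥0∞)⁻¹) (P : (Fin m → Fin n) → Prop) {p : ℝ}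
    (hp : 0 ≤ p)
    (h : ((Finset.univ.filter fun w => ¬ P w).card : ℝ) ≤ p * (n : ℝ) ^ m) :
    ENNReal.ofReal (1 - p) ≤ (Measure.pi fun _ : Fin m => ν) {w | P w} := by
  have hbad : (Measure.pi fun _ : Fin m => ν) {w | ¬ P w} ≤ ENNReal.ofReal p := by
    have e : {w | ¬ P w} = ((Finset.univ.filter fun w => ¬ P w : Finset (Fin m → Fin n)) :
        Set (Fin m → Fin n)) := by ext; simp
    rw [e, ← sum_measure_singleton]
    simp only [Measure.pi_singleton, hν, Finset.prod_const, Finset.card_univ, Fintype.card_fin,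
      Finset.sum_const, nsmul_eq_mul]
    have hn0 : (n : ℝ≥0∞) ^ m ≠ 0 := pow_ne_zero _ (by exact_mod_cast hn.ne')
    have hnt : (n : ℝ≥0∞) ^ m ≠ ⊤ := ENNReal.pow_ne_top (ENNReal.natCast_ne_top n)
    rw [← ENNReal.inv_pow, ← div_eq_mul_inv, ENNReal.div_le_iff hn0 hnt]
    have := ENNReal.ofReal_le_ofReal h
    rw [ENNReal.ofReal_mul hp, ENNReal.ofReal_pow (Nat.cast_nonneg n), ENNReal.ofReal_natCast,
      ENNReal.ofReal_natCast] at this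
    exact this
  rw [ENNReal.ofReal_sub _ hp, ENNReal.ofReal_one, tsub_le_iff_right]
  calc (1 : ℝ≥0∞) = (Measure.pi fun _ : Fin m => ν) Set.univ := measure_univ.symm
    _ ≤ (Measure.pi fun _ : Fin m => ν) ({w | P w} ∪ {w | ¬ P w}) := by
        refine measure_mono fun w _ => ?_
        exact Classical.em (P w)
    _ ≤ _ := (measure_union_le _ _).trans (by gcongr)

theorem norm_csgn_le_one {d : ℕ} (z : Fin d → ℂ) (i : Fin d) : ‖csgn z i‖ ≤ 1 := by
  rw [csgn]
  split_ifs with h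
  · simp
  · simp [h]

theorem projMat_mulVec {d : ℕ} (J : Set (Fin d)) (v : Fin d → ℂ) :
    (projMat J).mulVec v = fun i => if i ∈ J then v i else 0 := by
  funext i
  rw [Matrix.mulVec, dotProduct, Finset.sum_eq_single i]
  · by_cases h : i ∈ J <;> simp [projMat, h]
  · intro j _ hj
    simp [projMat, hj.symm]
  · simp

/-- An approximate certificate satisfies the three properties of an inexact dual certificate. -/
theorem ApproxCert.isInexactDual {n N : ℕ} {T : Matrix (Fin N) (Fin n) ℂ}
    {Tdag : Matrix (Fin n) (Fin N) ℂ} {J : Finset (Fin N)} {S : Set (Fin n)} {q v : Fin N → ℂ}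
    {ε B : ℝ} (hN : 0 < N) (hε : 0 ≤ ε) (hB : 0 ≤ B) (h : ApproxCert T J S q ε B v) :
    ((T * Tdag - T * projMat S * Tdag)ᴴ).mulVec v = 0 ∧
      l2norm ((projMat (J : Set (Fin N))).mulVec (v - q)) ≤ ε ∧
      linfnorm (((1 : Matrix (Fin N) (Fin N) ℂ) - projMat (J : Set (Fin N))).mulVec v) ≤ B := by
  refine ⟨?_, ?_, ?_⟩
  · have hP : (projMat S)ᴴ = projMat S := by
      ext i j
      by_cases hij : i = j
      · subst hij
        by_cases hi : i ∈ S <;> simp [projMat, hi]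
      · simp [projMat, hij, Ne.symm hij]
    have hv : (projMat S).mulVec (Tᴴ.mulVec v) = Tᴴ.mulVec v := by
      rw [projMat_mulVec]
      funext k
      by_cases hk : k ∈ S
      · simp [hk]
      · simp [hk, h.1 k hk]
    rw [Matrix.conjTranspose_sub, Matrix.conjTranspose_mul, Matrix.conjTranspose_mul,
      Matrix.conjTranspose_mul, hP, Matrix.sub_mulVec, ← Matrix.mulVec_mulVec,
      ← Matrix.mulVec_mulVec, ← Matrix.mulVec_mulVec, hv, sub_self]
  · refine abs_le_of_sq_le_sq' ?_ hε |>.2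
    rw [l2norm_sq, projMat_mulVec]
    refine le_of_eq_of_le ?_ h.2.1
    rw [← Finset.sum_subset (Finset.subset_univ J) fun i _ hi => by simp [hi]]
    exact Finset.sum_congr rfl fun i hi => by simp [hi]
  · have : Nonempty (Fin N) := ⟨⟨0, hN⟩⟩
    refine ciSup_le fun i => ?_
    rw [Matrix.sub_mulVec, Matrix.one_mulVec, projMat_mulVec, Pi.sub_apply]
    by_cases hi : i ∈ J
    · simpa [hi] using hB
    · simpa [hi] using h.2.2 i hi

/-- The golfing precision is finer than the precision required of an inexact dual certificate. -/
theorem exp_mul_sqrt_le_precision {n N t : ℕ} {κ : ℝ} (hn : 0 < n) (hN : 2 ≤ N) (hnN : n ≤ N)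
    (ht : t ≤ N) (hκ : 1 ≤ κ) :
    Real.exp (-(2 * (2 * (Real.log N + Real.log κ)))) * (√t / 4) ≤ 1 / (7 * n * κ) := by
  have hn' : (0 : ℝ) < n := by exact_mod_cast hn
  have hN' : (2 : ℝ) ≤ N := by exact_mod_cast hN
  have hnN' : (n : ℝ) ≤ N := by exact_mod_cast hnN
  have hκ0 : 0 < κ := by linarith
  have hsqrt : √(t : ℝ) ≤ N := by
    rw [Real.sqrt_le_left (by linarith)]
    have : (t : ℝ) ≤ N := by exact_mod_cast ht
    nlinarith
  have hexp : Real.exp (-(2 * (2 * (Real.log N + Real.log κ)))) = ((N * κ) ^ 4)⁻¹ := by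
    rw [← Real.log_mul (by positivity) hκ0.ne', Real.exp_neg, ← Real.exp_log
      (by positivity : 0 < ((N : ℝ) * κ) ^ 4), Real.log_pow]
    congr 2
    push_cast
    ring
  rw [hexp, inv_mul_eq_div, div_le_div_iff₀ (by positivity) (by positivity)]
  have hNκ : 2 ≤ N * κ := by nlinarith
  have h1 : n * κ * √(t : ℝ) ≤ (N * κ) ^ 2 := by
    calc n * κ * √(t : ℝ) ≤ (N * κ) * (N * κ) := by
          refine mul_le_mul (by gcongr) (hsqrt.trans ?_) (Real.sqrt_nonneg _) (by positivity)
          nlinarith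
      _ = _ := (sq _).symm
  nlinarith [sq_nonneg ((N * κ) ^ 2 - 4), mul_le_mul hNκ hNκ (by norm_num) (by positivity)]

/-- The number of samples suffices for golfing at logarithmic scale `2 * L`. -/
theorem golfing_samples_le {b μ t s δ L m : ℝ} (hb : 0 ≤ b) (hμ : 0 ≤ μ) (hts : t ≤ s)
    (ht : 0 ≤ t) (hδ : 0 ≤ δ) (hδ1 : δ < 1) (hL : 0 ≤ L)
    (hm : 272000 * b * μ * s / (1 - δ) * L ≤ m) :
    136000 * b * (μ * t) * (2 * L) ≤ m := by
  refine le_trans ?_ hm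
  have hs : 0 ≤ s := ht.trans hts
  calc 136000 * b * (μ * t) * (2 * L) = 272000 * b * μ * t * L := by ring
    _ ≤ 272000 * b * μ * s * L := by gcongr
    _ ≤ _ := by
      refine mul_le_mul_of_nonneg_right ?_ hL
      exact le_div_self (by positivity) (by linarith) (by linarith)

/-- Lemma 2 (existence of an inexact dual certificate). -/
theorem existence_of_inexact_dual_certificate :
    ∃ C : ℝ, 0 < C ∧
      ∀ (n N m s : ℕ), 0 < n → 0 < N → 0 < m → 0 < s →
      ∀ (T : Matrix (Fin N) (Fin n) ℂ) (Tdag : Matrix (Fin n) (Fin N) ℂ) (γ β : ℝ)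
        (x : Fin n → ℂ) (J : Set (Fin N))
        (ν : Measure (Fin n)) [IsProbabilityMeasure ν],
        Function.Injective T.mulVec →
        IsMoorePenrose T Tdag →
        IsBalancing T γ →
        specNorm ((γ : ℂ) • (Tᴴ * T) - 1) < 1 →
        (∀ k, ν {k} = (n : ℝ≥0∞)⁻¹) →
        sparsity (T.mulVec x) ≤ s →
        J = {i | T.mulVec x i ≠ 0} →
        0 < β →
        (m : ℝ) ≥ C * (1 + β) * incoherence γ T Tdagᴴ * s /
            (1 - specNorm ((γ : ℂ) • (Tᴴ * T) - 1)) *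
            (Real.log N + Real.log (maxColL2 T * maxColL2 Tdagᴴ)) →
        (Measure.pi fun _ : Fin m => ν)
            {ω | ∃ v : Fin N → ℂ,
                ((T * Tdag - T * projMat (Set.range ω) * Tdag)ᴴ).mulVec v = 0 ∧
                l2norm ((projMat J).mulVec (v - csgn (T.mulVec x))) ≤
                  1 / (7 * n * maxColL2 T * maxColL2 Tdagᴴ) ∧
                linfnorm (((1 : Matrix (Fin N) (Fin N) ℂ) - projMat J).mulVec v) ≤ 1 / 2} ≥
          ENNReal.ofReal (1 - Real.exp (-β) - 1 / n) := by
  refine ⟨272000, by norm_num, ?_⟩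
  rintro n N m s hn hN _ _ T Tdag γ β x _ ν _ hinj hMP ⟨hγ, _⟩ hδ hν hs rfl hβ hm
  set κ := maxColL2 T * maxColL2 Tdagᴴ with hκdef
  set μ := incoherence γ T Tdagᴴ
  set J : Finset (Fin N) := Finset.univ.filter fun i => T.mulVec x i ≠ 0 with hJdef
  have hJ : {i | T.mulVec x i ≠ 0} = (J : Set (Fin N)) := by simp [hJdef]
  have hJs : J.card ≤ s := hs
  have h1 := mul_eq_one_of_isMoorePenrose hinj hMP
  have hnN := card_le_of_mulVec_injective hinj
  have hκ : 1 ≤ κ := one_le_maxColL2_mul hn h1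
  have hq0 : ∀ i ∉ J, csgn (T.mulVec x) i = 0 := fun i hi => by simpa [csgn, hJdef] using hi
  have hε : 0 ≤ 1 / (7 * n * κ) := by positivity
  suffices key : ENNReal.ofReal (1 - Real.exp (-β) - 1 / n) ≤
      (Measure.pi fun _ : Fin m => ν) {w | ∃ v : Fin N → ℂ,
        ApproxCert T J (Set.range w) (csgn (T.mulVec x)) (1 / (7 * n * κ)) (1 / 2) v} by
    refine key.trans (measure_mono ?_)
    rintro w ⟨v, hv⟩
    have h := hv.isInexactDual (Tdag := Tdag) hN hε (by norm_num)
    rw [hκdef, ← mul_assoc] at h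
    rw [Set.mem_ofPred_eq, hJ]
    exact ⟨v, h⟩
  by_cases hn1 : n = 1
  · have : 1 - Real.exp (-β) - 1 / (n : ℝ) ≤ 0 := by
      rw [hn1]
      have := Real.exp_pos (-β)
      norm_num
      exact this.le
    rw [ENNReal.ofReal_of_nonpos this]
    exact zero_le
  have hle : ENNReal.ofReal (1 - Real.exp (-β) - 1 / n) ≤ ENNReal.ofReal (1 - Real.exp (-β)) :=
    ENNReal.ofReal_le_ofReal (sub_le_self _ (by positivity))
  refine hle.trans (ofReal_le_pi_of_card_le hn ν hν _ (Real.exp_pos _).le ?_)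
  rcases J.eq_empty_or_nonempty with hJe | hJne
  · rw [Finset.filter_false_of_mem]
    · simp only [Finset.card_empty, Nat.cast_zero]
      positivity
    · intro w _
      rw [not_not]
      exact ⟨0, fun k _ => by simp, by simp only [hJe, Finset.sum_empty]; positivity,
        fun i _ => by simp⟩
  have hx : x ≠ 0 := by
    rintro rfl
    simp [hJdef] at hJne
  have hJ0 := hJne.card_pos
  have hinc := fun i k => norm_sq_le_incoherence (T := T) (U := Tdagᴴ) hγ i k
  have hμJ : 1 / 2 ≤ μ * J.card := half_le_mul_card_support hn hγ h1 (fun i k => (hinc i k).1)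
    (sum_norm_sq_mulVec_le hγ hδ.le) x hx J fun i hi => by simpa [hJdef] using hi
  have hJpos : (0 : ℝ) < J.card := by exact_mod_cast hJ0
  have hμ : 0 < μ := pos_of_mul_pos_left (by linarith) hJpos.le
  have hG : GolfBounds Tdagᴴ T γ μ :=
    ⟨hn, hγ, hμ, fun i k => (hinc i k).1, fun i k => (hinc i k).2,
      sum_norm_sq_adjoint_mulVec_le hγ hδ.le⟩
  have hTU : Tᴴ * Tdagᴴ = 1 := by
    rw [← Matrix.conjTranspose_mul, h1, Matrix.conjTranspose_one]
  have hN2 : 2 ≤ N := by omega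
  have hlogN : 1 / 2 ≤ Real.log N :=
    (by linarith [Real.log_two_gt_d9] : (1 : ℝ) / 2 ≤ Real.log 2).trans
      (Real.log_le_log (by norm_num) (by exact_mod_cast hN2))
  have hlogκ : 0 ≤ Real.log κ := Real.log_nonneg hκ
  set L := Real.log N + Real.log κ with hL
  have hNexp : (N : ℝ) ≤ Real.exp (2 * L) := by
    rw [← Real.log_le_iff_le_exp (by positivity)]
    linarith
  refine le_trans ?_ (card_golfing_fail_le hG hTU J hJ0 hμJ (l := 2 * L) (by linarith) hβ
    hNexp (golfing_samples_le (by linarith) hμ.le (by exact_mod_cast hJs) hJpos.le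
      (norm_nonneg _) hδ (by linarith) hm) (csgn (T.mulVec x)) hq0 (norm_csgn_le_one _))
  refine Nat.cast_le.2 (Finset.card_le_card fun w hw => ?_)
  rw [Finset.mem_filter] at hw ⊢
  refine ⟨hw.1, fun ⟨v, hv⟩ => hw.2 ⟨v, hv.mono subset_rfl ?_ le_rfl⟩⟩
  exact pow_le_pow_left₀ (by positivity) (exp_mul_sqrt_le_precision hn hN2 hnN
    ((Finset.card_le_univ J).trans_eq (Fintype.card_fin N)) hκ) 2

end TSR
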